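/- arXiv:1809.00712 — 3 statements merged into one kernel-verified Lean document; each statement's English description precedes it below -/
import Mathlib

section
/- Let V be a finite nonempty vertex set and let G be a tree on V (a connected acyclic simple graph). Given initial values x₀ : V → ℝ, define the finite-time averaging iteration x : ℕ → V → ℝ by x 0 = x₀; x 1 a = x₀ a + ∑_{b adjacent to a} x₀ b; and for q ≥ 1, x (q+1) a = ∑_{b adjacent to a} x q b + (1 − deg(a)) · x (q−1) a, where deg(a) is the degree of a in G. Then for every vertex a and every natural number q, x q a = ∑_{v : dist_G(v,a) ≤ q} x₀ v, the sum of the initial values over all vertices within graph distance q of a. -/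
/-- In a tree, every vertex `a ≠ v` has exactly one neighbor closer to `v`; all its other neighbors
are further away from `v`. -/
theorem SimpleGraph.IsTree.exists_adj_dist_eq {V : Type*} {G : SimpleGraph V} (hG : G.IsTree)
    {v a : V} (hne : v ≠ a) :
    ∃ c, G.Adj a c ∧ G.dist v a = G.dist v c + 1 ∧
      ∀ b, G.Adj a b → b ≠ c → G.dist v b = G.dist v a + 1 := by
  have closer_unique : ∀ (p : G.Walk v a), p.IsPath → ∀ b, G.Adj a b →
      G.dist v a = G.dist v b + 1 → b = p.penultimate := by
    intro p hp b hab hb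
    obtain ⟨r, hr, hrl⟩ := hG.connected.exists_path_of_dist v b
    have hq : (r.concat hab.symm).IsPath :=
      Walk.isPath_of_length_eq_dist _ (by rw [Walk.length_concat, hrl, hb])
    have hpq : p = r.concat hab.symm :=
      congrArg Subtype.val ((hG.isAcyclic.subsingleton_path v a).elim ⟨p, hp⟩ ⟨_, hq⟩)
    rw [hpq, Walk.penultimate_concat]
  obtain ⟨p, hp, hpl⟩ := hG.connected.exists_path_of_dist v a
  have hnil : ¬ p.Nil := Walk.not_nil_of_ne hne
  have hadj : G.Adj p.penultimate a := p.adj_penultimate hnil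
  refine ⟨p.penultimate, hadj.symm, ?_, fun b hab hb => ?_⟩
  · have h1 : G.dist v p.penultimate ≤ p.dropLast.length := dist_le _
    have h2 : p.dropLast.length + 1 = p.length := Walk.length_dropLast_add_one hnil
    have h3 := hG.dist_eq_dist_add_one_of_adj v hadj
    lia
  · exact (hG.dist_eq_dist_add_one_of_adj v hab).resolve_left
      fun h => hb (closer_unique p hp b hab h)

/-- On a tree, the indicator functions of closed balls satisfy the averaging recursion. -/
theorem SimpleGraph.IsTree.indicator_dist_le_add_one {V : Type*} [Fintype V] {G : SimpleGraph V}
    [DecidableRel G.Adj] (hG : G.IsTree) {q : ℕ} (hq : 1 ≤ q) (v a : V) :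
    (if G.dist v a ≤ q + 1 then (1 : ℝ) else 0) =
      (∑ b ∈ G.neighborFinset a, if G.dist v b ≤ q then (1 : ℝ) else 0) +
        (1 - (G.degree a : ℝ)) * if G.dist v a ≤ q - 1 then (1 : ℝ) else 0 := by
  classical
  by_cases hne : v = a
  · subst hne
    have h : ∀ b ∈ G.neighborFinset v, (if G.dist v b ≤ q then (1 : ℝ) else 0) = 1 := by
      intro b hb
      rw [if_pos]
      rwa [dist_eq_one_iff_adj.mpr ((G.mem_neighborFinset v b).mp hb)]
    rw [Finset.sum_congr rfl h]
    simp
  · obtain ⟨c, hac, hc, hfar⟩ := hG.exists_adj_dist_eq hne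
    have hmem : c ∈ G.neighborFinset a := (G.mem_neighborFinset a c).mpr hac
    have h : ∀ b ∈ (G.neighborFinset a).erase c, (if G.dist v b ≤ q then (1 : ℝ) else 0) =
        if G.dist v a ≤ q - 1 then (1 : ℝ) else 0 := by
      intro b hb
      rw [Finset.mem_erase, mem_neighborFinset] at hb
      rw [hfar b hb.2 hb.1]
      exact if_congr (by lia) rfl rfl
    rw [← Finset.add_sum_erase _ _ hmem, Finset.sum_congr rfl h, Finset.sum_const, nsmul_eq_mul,
      Finset.cast_card_erase_of_mem hmem, card_neighborFinset_eq_degree,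
      if_congr (show G.dist v a ≤ q + 1 ↔ G.dist v c ≤ q by lia) rfl rfl]
    ring

/-- **Finite-time averaging on a tree, partial sums.**
On a tree `G` with initial values `x₀`, the iteration
`x 0 = x₀`, `x 1 a = x₀ a + ∑_{b ~ a} x₀ b`, and for `q ≥ 1`
`x (q+1) a = ∑_{b ~ a} x q b + (1 - deg a) * x (q-1) a`
satisfies `x q a = ∑_{v : dist(v,a) ≤ q} x₀ v`. -/
theorem finite_time_averaging_partial_sums
    {V : Type*} [Fintype V] [Nonempty V] (G : SimpleGraph V) [DecidableRel G.Adj]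
    (hG : G.IsTree) (x₀ : V → ℝ) (x : ℕ → V → ℝ)
    (h0 : ∀ a : V, x 0 a = x₀ a)
    (h1 : ∀ a : V, x 1 a = x₀ a + ∑ b ∈ G.neighborFinset a, x₀ b)
    (hrec : ∀ q : ℕ, 1 ≤ q → ∀ a : V,
      x (q + 1) a = (∑ b ∈ G.neighborFinset a, x q b)
        + (1 - (G.degree a : ℝ)) * x (q - 1) a) :
    ∀ (a : V) (q : ℕ),
      x q a = ∑ v ∈ Finset.univ.filter (fun v => G.dist v a ≤ q), x₀ v := by
  classical
  suffices h : ∀ (q : ℕ) (a : V),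
      x q a = ∑ v, x₀ v * if G.dist v a ≤ q then (1 : ℝ) else 0 by
    intro a q
    simp [h q a, Finset.sum_filter]
  intro q
  induction q using Nat.strong_induction_on with
  | _ q ih =>
    intro a
    match q, ih with
    | 0, _ => simp [h0, hG.connected.dist_eq_zero_iff]
    | 1, _ =>
      have hball : Finset.univ.filter (fun v => G.dist v a ≤ 1) =
          insert a (G.neighborFinset a) := by
        ext v
        simp [Nat.le_one_iff_eq_zero_or_eq_one, hG.connected.dist_eq_zero_iff,
          SimpleGraph.dist_eq_one_iff_adj, G.adj_comm v a]
      simp only [mul_ite, mul_one, mul_zero]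
      rw [h1, ← Finset.sum_filter, hball, Finset.sum_insert (by simp)]
    | q + 2, ih =>
      rw [hrec (q + 1) (by lia) a, Finset.sum_congr rfl fun b _ => ih (q + 1) (by lia) b,
        ih (q + 1 - 1) (by lia) a, Finset.sum_comm, Finset.mul_sum, ← Finset.sum_add_distrib]
      refine Finset.sum_congr rfl fun v _ => ?_
      rw [hG.indicator_dist_le_add_one (by lia : 1 ≤ q + 1) v a, ← Finset.mul_sum]
      ring
end

section
/- Let V be a finite nonempty vertex set and let G be a tree on V with diameter d (the maximum of dist_G(u,v) over all pairs of vertices). Given initial values x₀ : V → ℝ, define the finite-time averaging iteration x : ℕ → V → ℝ by x 0 = x₀; x 1 a = x₀ a + ∑_{b adjacent to a} x₀ b; and for q ≥ 1, x (q+1) a = ∑_{b adjacent to a} x q b + (1 − deg(a)) · x (q−1) a. Then for every vertex a and every q ≥ d, x q a = ∑_{v ∈ V} x₀ v; in particular, after at most d steps every vertex holds the sum of all initial values. -/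
/-- In a tree, a vertex `a` other than `v` has exactly one neighbor that is nearer to `v`;
all other neighbors are farther away. -/
theorem SimpleGraph.IsTree.exists_adj_dist_add_one_eq
    {V : Type*} {G : SimpleGraph V} (hG : G.IsTree) {a v : V} (hav : a ≠ v) :
    ∃ c, G.Adj a c ∧ G.dist c v + 1 = G.dist a v ∧
      ∀ b, G.Adj a b → b ≠ c → G.dist b v = G.dist a v + 1 := by
  obtain ⟨p, hp, hlen⟩ := hG.connected.exists_path_of_dist a v
  cases p with
  | nil => exact absurd rfl hav
  | @cons _ c _ hac p =>
    have hcases (b : V) (hab : G.Adj a b) :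
        G.dist b v + 1 = G.dist a v ∨ G.dist b v = G.dist a v + 1 := by
      have := hG.dist_eq_dist_add_one_of_adj v hab
      rw [G.dist_comm (u := v), G.dist_comm (u := v)] at this
      omega
    refine ⟨c, hac, ?_, fun b hab hbc => ?_⟩
    · have := G.dist_le p
      have := hcases c hac
      rw [SimpleGraph.Walk.length_cons] at hlen
      omega
    · refine (hcases b hab).resolve_left fun hb => hbc ?_
      obtain ⟨q, -, hqlen⟩ := hG.connected.exists_path_of_dist b v
      have hq : (SimpleGraph.Walk.cons hab q).IsPath :=
        SimpleGraph.Walk.isPath_of_length_eq_dist _ (by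
          rw [SimpleGraph.Walk.length_cons, hqlen, hb])
      have := (hG.existsUnique_path a v).unique hq hp
      simpa using congrArg SimpleGraph.Walk.snd this

/-- The indicator of a ball in a tree satisfies the second-order averaging recursion. -/
theorem SimpleGraph.IsTree.ball_indicator_recursion
    {V : Type*} [Fintype V] {G : SimpleGraph V} [DecidableRel G.Adj] (hG : G.IsTree)
    {q : ℕ} (hq : 1 ≤ q) (a v : V) :
    (∑ b ∈ G.neighborFinset a, if G.dist b v ≤ q then (1 : ℝ) else 0)
        + (1 - (G.degree a : ℝ)) * (if G.dist a v ≤ q - 1 then 1 else 0)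
      = if G.dist a v ≤ q + 1 then 1 else 0 := by
  classical
  by_cases hav : a = v
  · subst hav
    have hsum : (∑ b ∈ G.neighborFinset a, if G.dist b a ≤ q then (1 : ℝ) else 0)
        = G.degree a := by
      rw [← G.card_neighborFinset_eq_degree, Finset.cast_card]
      refine Finset.sum_congr rfl fun b hb => if_pos ?_
      rw [SimpleGraph.dist_eq_one_iff_adj.2 ((G.mem_neighborFinset a b).1 hb).symm]
      exact hq
    rw [hsum]
    simp
  · obtain ⟨c, hac, hc, hfar⟩ := hG.exists_adj_dist_add_one_eq hav
    have hmem : c ∈ G.neighborFinset a := (G.mem_neighborFinset a c).2 hac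
    have hsum : (∑ b ∈ (G.neighborFinset a).erase c, if G.dist b v ≤ q then (1 : ℝ) else 0)
        = (G.degree a - 1) * (if G.dist a v ≤ q - 1 then 1 else 0) := by
      rw [Finset.sum_congr (g := fun _ => if G.dist a v ≤ q - 1 then (1 : ℝ) else 0) rfl]
      · rw [Finset.sum_const, nsmul_eq_mul, Finset.cast_card_erase_of_mem hmem,
          G.card_neighborFinset_eq_degree]
      · intro b hb
        obtain ⟨hbc, hb⟩ := Finset.mem_erase.1 hb
        rw [hfar b ((G.mem_neighborFinset a b).1 hb) hbc]
        exact if_congr (by omega) rfl rfl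
    rw [← Finset.add_sum_erase _ _ hmem, hsum,
      if_congr (show G.dist c v ≤ q ↔ G.dist a v ≤ q + 1 by omega) rfl rfl]
    ring

/-- The averaging iteration computes, at step `q`, the sum of the initial values over the ball of
radius `q`. -/
theorem averaging_iteration_eq_sum_ball
    {V : Type*} [Fintype V] {G : SimpleGraph V} [DecidableRel G.Adj] (hG : G.IsTree)
    {x₀ : V → ℝ} {x : ℕ → V → ℝ} (h0 : ∀ a : V, x 0 a = x₀ a)
    (h1 : ∀ a : V, x 1 a = x₀ a + ∑ b ∈ G.neighborFinset a, x₀ b)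
    (hrec : ∀ q : ℕ, 1 ≤ q → ∀ a : V,
      x (q + 1) a = (∑ b ∈ G.neighborFinset a, x q b)
        + (1 - (G.degree a : ℝ)) * x (q - 1) a) (q : ℕ) (a : V) :
    x q a = ∑ v : V, (if G.dist a v ≤ q then 1 else 0) * x₀ v := by
  classical
  induction q using Nat.strong_induction_on generalizing a with
  | _ q ih =>
    match q with
    | 0 => simp [h0, hG.connected.dist_eq_zero_iff]
    | 1 =>
      have hball : ({v | G.dist a v ≤ 1} : Finset V) = insert a (G.neighborFinset a) := by
        ext v
        rw [Finset.mem_filter_univ, Finset.mem_insert, G.mem_neighborFinset,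
          ← SimpleGraph.dist_eq_one_iff_adj, eq_comm (a := v),
          ← hG.connected.dist_eq_zero_iff]
        omega
      simp_rw [ite_mul, one_mul, zero_mul]
      rw [h1, ← Finset.sum_filter, hball, Finset.sum_insert (by simp)]
    | q + 2 =>
      rw [hrec (q + 1) (by omega), ih (q + 1 - 1) (by omega),
        Finset.sum_congr rfl fun b _ => ih (q + 1) (by omega) b,
        Finset.sum_comm, Finset.mul_sum, ← Finset.sum_add_distrib]
      refine Finset.sum_congr rfl fun v _ => ?_
      rw [← hG.ball_indicator_recursion (q := q + 1) (by omega) a v, add_mul, Finset.sum_mul,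
        mul_assoc]

/-- **Finite-time averaging on a tree converges in diameter many steps.**
On a tree `G` of diameter `d` with initial values `x₀`, the iteration
`x 0 = x₀`, `x 1 a = x₀ a + ∑_{b ~ a} x₀ b`, and for `q ≥ 1`
`x (q+1) a = ∑_{b ~ a} x q b + (1 - deg a) * x (q-1) a`
satisfies `x q a = ∑_v x₀ v` for every `q ≥ d`. -/
theorem finite_time_averaging_converges_in_diam_steps
    {V : Type*} [Fintype V] [Nonempty V] (G : SimpleGraph V) [DecidableRel G.Adj]
    (hG : G.IsTree) (d : ℕ)
    (hd : d = Finset.univ.sup (fun p : V × V => G.dist p.1 p.2))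
    (x₀ : V → ℝ) (x : ℕ → V → ℝ)
    (h0 : ∀ a : V, x 0 a = x₀ a)
    (h1 : ∀ a : V, x 1 a = x₀ a + ∑ b ∈ G.neighborFinset a, x₀ b)
    (hrec : ∀ q : ℕ, 1 ≤ q → ∀ a : V,
      x (q + 1) a = (∑ b ∈ G.neighborFinset a, x q b)
        + (1 - (G.degree a : ℝ)) * x (q - 1) a) :
    ∀ (a : V) (q : ℕ), d ≤ q → x q a = ∑ v : V, x₀ v := by
  intro a q hq
  rw [averaging_iteration_eq_sum_ball hG h0 h1 hrec]
  refine Finset.sum_congr rfl fun v _ => ?_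
  have hav : G.dist a v ≤ d := hd ▸
    Finset.le_sup (f := fun p : V × V => G.dist p.1 p.2) (Finset.mem_univ (a, v))
  rw [if_pos (hav.trans hq), one_mul]
end

section
/- Let W ≥ 1 agents be indexed by a ∈ Fin W, each with a constraint interval X_a = [lo_a, hi_a] ⊆ ℝ (lo_a ≤ hi_a) such that the intersection X = ∩_a X_a is nonempty, and with a convex differentiable objective f_a : ℝ → ℝ whose derivative is continuous. Let the stepsizes α_k > 0 satisfy ∑_k α_k = ∞ and ∑_k α_k² < ∞. Define the projected consensus iterates by x_a(0) ∈ X_a and x_a(k+1) = Π_{X_a}[ (1/W) ∑_{b} x_b(k) − α_k f_a'(x_a(k)) ], where Π_{X_a} is the Euclidean projection (clamp) onto [lo_a, hi_a]. Then there exists x* ∈ X minimizing ∑_a f_a over X such that lim_{k→∞} x_a(k) = x* for every agent a; in particular all agents' iterates converge to a common optimal solution. -/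
open Filter

open Topology

/-- A nonnegative sequence that decreases up to a summable error converges, and its decrements
are summable. -/
theorem exists_tendsto_and_summable_of_le_sub_add {D u c : ℕ → ℝ} (hD : ∀ k, 0 ≤ D k)
    (hu : ∀ k, 0 ≤ u k) (hc : ∀ k, 0 ≤ c k) (hcs : Summable c)
    (h : ∀ k, D (k + 1) ≤ D k - u k + c k) :
    (∃ l, Tendsto D atTop (𝓝 l)) ∧ Summable u := by
  have hpart : ∀ n, ∑ i ∈ Finset.range n, c i ≤ ∑' i, c i := fun n =>
    hcs.sum_le_tsum _ fun i _ => hc i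
  constructor
  · have hanti : Antitone fun n => D n - ∑ i ∈ Finset.range n, c i :=
      antitone_nat_of_succ_le fun n => by
        rw [Finset.sum_range_succ]
        linarith [h n, hu n]
    have hbdd : BddBelow (Set.range fun n => D n - ∑ i ∈ Finset.range n, c i) := by
      refine ⟨-∑' i, c i, ?_⟩
      rintro _ ⟨n, rfl⟩
      have := hpart n
      have := hD n
      dsimp only
      linarith
    have hlim := (tendsto_atTop_ciInf hanti hbdd).add hcs.hasSum.tendsto_sum_nat
    simp only [sub_add_cancel] at hlim
    exact ⟨_, hlim⟩
  · refine summable_of_sum_range_le (c := D 0 + ∑' i, c i) hu fun n => ?_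
    have htel : ∑ i ∈ Finset.range n, u i ≤ D 0 - D n + ∑ i ∈ Finset.range n, c i := by
      induction n with
      | zero => simp
      | succ n ih =>
        rw [Finset.sum_range_succ, Finset.sum_range_succ]
        linarith [h n]
    linarith [hD n, hpart n]

/-- If the weights `α` are not summable but `α * h` is, then `h` is frequently small. -/
theorem frequently_lt_of_summable_mul {α h : ℕ → ℝ} (hα : ∀ k, 0 < α k) (hαdiv : ¬ Summable α)
    (hs : Summable fun k => α k * h k) {ε : ℝ} (hε : 0 < ε) :
    ∃ᶠ k in atTop, h k < ε := by
  intro hev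
  obtain ⟨N, hN⟩ := eventually_atTop.1 hev
  refine hαdiv ((summable_nat_add_iff N).1 ?_)
  refine Summable.of_nonneg_of_le (fun k => (hα _).le) (fun k => ?_)
    (((summable_nat_add_iff N).2 hs).mul_left ε⁻¹)
  have hle : ε ≤ h (k + N) := not_lt.1 (hN _ (Nat.le_add_left N k))
  rw [inv_mul_eq_div, le_div_iff₀ hε]
  exact mul_le_mul_of_nonneg_left hle (hα _).le

/-- Clamping to an interval does not increase the distance to a point of the interval. -/
theorem sq_clamp_sub_le {l u w z : ℝ} (hl : l ≤ z) (hu : z ≤ u) :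
    (min (max w l) u - z) ^ 2 ≤ (w - z) ^ 2 := by
  rw [sq_le_sq]
  have hz : min (max z l) u = z := by rw [max_eq_left hl, min_eq_left hu]
  calc |min (max w l) u - z| = |min (max w l) u - min (max z l) u| := by rw [hz]
    _ ≤ |max w l - max z l| := by
      simpa using abs_min_sub_min_le_max (max w l) u (max z l) u
    _ ≤ |w - z| := abs_max_sub_max_le_abs _ _ _

/-- Tangent line inequality for a differentiable convex function on the line. -/
theorem ConvexOn.add_deriv_mul_sub_le {f : ℝ → ℝ} (hf : ConvexOn ℝ Set.univ f)
    (hd : Differentiable ℝ f) (y z : ℝ) : f y + deriv f y * (z - y) ≤ f z := by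
  rcases lt_trichotomy y z with h | rfl | h
  · have := hf.deriv_le_slope (Set.mem_univ y) (Set.mem_univ z) h (hd y)
    rw [slope_def_field, le_div_iff₀ (sub_pos.2 h)] at this
    linarith
  · simp
  · have := hf.slope_le_deriv (Set.mem_univ z) (Set.mem_univ y) h (hd y)
    rw [slope_def_field, div_le_iff₀ (sub_pos.2 h)] at this
    linarith

/-- The distance of `v` to a nonempty intersection of intervals is at most the sum of the distances
of `v` to arbitrary points of these intervals. -/
theorem exists_mem_iInter_Icc_abs_sub_le {ι : Type*} [Fintype ι] [Nonempty ι] {lo hi x : ι → ℝ}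
    (hne : (⋂ a, Set.Icc (lo a) (hi a)).Nonempty) (hx : ∀ a, x a ∈ Set.Icc (lo a) (hi a)) (v : ℝ) :
    ∃ s ∈ ⋂ a, Set.Icc (lo a) (hi a), |v - s| ≤ ∑ a, |x a - v| := by
  obtain ⟨z, hz⟩ := hne
  rw [Set.mem_iInter] at hz
  obtain ⟨i, hi_max⟩ := Finite.exists_max lo
  obtain ⟨j, hj_min⟩ := Finite.exists_min hi
  have hsum : ∀ a, |x a - v| ≤ ∑ b, |x b - v| := fun a =>
    Finset.single_le_sum (f := fun b => |x b - v|) (fun _ _ => abs_nonneg _) (Finset.mem_univ a)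
  have hij : lo i ≤ hi j := (hz i).1.trans (hz j).2
  rcases lt_or_ge v (lo i) with h | h
  · refine ⟨lo i, Set.mem_iInter.2 fun a => ⟨hi_max a, hij.trans (hj_min a)⟩, ?_⟩
    refine le_trans ?_ (hsum i)
    rw [abs_of_neg (sub_neg.2 h)]
    linarith [(hx i).1, le_abs_self (x i - v)]
  rcases lt_or_ge (hi j) v with h' | h'
  · refine ⟨hi j, Set.mem_iInter.2 fun a => ⟨(hi_max a).trans hij, hj_min a⟩, ?_⟩
    refine le_trans ?_ (hsum j)
    rw [abs_of_pos (sub_pos.2 h')]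
    linarith [(hx j).2, neg_abs_le (x j - v)]
  · refine ⟨v, Set.mem_iInter.2 fun a => ⟨(hi_max a).trans h, h'.trans (hj_min a)⟩, ?_⟩
    rw [sub_self, abs_zero]
    exact Finset.sum_nonneg fun _ _ => abs_nonneg _

/-- Basic estimate for one projected consensus step with directions `g` and average `v`. -/
theorem sum_sq_clamp_sub_le {ι : Type*} [Fintype ι] {lo hi x g : ι → ℝ} {v z α : ℝ}
    (hz : ∀ a, z ∈ Set.Icc (lo a) (hi a)) (hv : ∑ a, x a = Fintype.card ι * v) :
    ∑ a, (min (max (v - α * g a) (lo a)) (hi a) - z) ^ 2 ≤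
      ∑ a, (x a - z) ^ 2 - ∑ a, (x a - v) ^ 2 - 2 * α * ∑ a, g a * (v - z) +
        α ^ 2 * ∑ a, g a ^ 2 := by
  have hlin : ∑ a, 2 * (v - z) * (x a - v) = 0 := by
    rw [← Finset.mul_sum, Finset.sum_sub_distrib, hv]
    simp
  calc ∑ a, (min (max (v - α * g a) (lo a)) (hi a) - z) ^ 2
      ≤ ∑ a, (v - α * g a - z) ^ 2 :=
        Finset.sum_le_sum fun a _ => sq_clamp_sub_le (hz a).1 (hz a).2
    _ = ∑ a, ((x a - z) ^ 2 - (x a - v) ^ 2 - 2 * α * (g a * (v - z)) + α ^ 2 * g a ^ 2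
          - 2 * (v - z) * (x a - v)) := Finset.sum_congr rfl fun a _ => by ring
    _ = _ := by
      rw [Finset.sum_sub_distrib, hlin, Finset.sum_add_distrib, Finset.sum_sub_distrib,
        Finset.sum_sub_distrib, Finset.mul_sum, Finset.mul_sum, sub_zero]

/-- Lower bound for the descent term of a consensus gradient step by the optimality gap at a
feasible point `s` near the average `v`. -/
theorem sub_le_sum_deriv_mul_sub {ι : Type*} [Fintype ι] {f : ι → ℝ → ℝ}
    (hconv : ∀ a, ConvexOn ℝ Set.univ (f a)) (hdiff : ∀ a, Differentiable ℝ (f a))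
    {x : ι → ℝ} {v s z G : ℝ} (hGx : ∀ a, |deriv (f a) (x a)| ≤ G)
    (hGs : ∀ a, |deriv (f a) s| ≤ G) (hG : 0 ≤ G) (hs : |v - s| ≤ ∑ a, |x a - v|) :
    ∑ a, f a s - ∑ a, f a z - (Fintype.card ι + 2) * G * ∑ a, |x a - v| ≤
      ∑ a, deriv (f a) (x a) * (v - z) := by
  have hterm : ∀ a, f a s - f a z - 2 * G * |x a - v| - G * ∑ b, |x b - v| ≤
      deriv (f a) (x a) * (v - z) := fun a => by
    have h₁ := (hconv a).add_deriv_mul_sub_le (hdiff a) (x a) z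
    have h₂ := (hconv a).add_deriv_mul_sub_le (hdiff a) s (x a)
    have h₃ : |deriv (f a) (x a) * (x a - v)| ≤ G * |x a - v| := by
      rw [abs_mul]
      exact mul_le_mul_of_nonneg_right (hGx a) (abs_nonneg _)
    have h₄ : |deriv (f a) s * (x a - v)| ≤ G * |x a - v| := by
      rw [abs_mul]
      exact mul_le_mul_of_nonneg_right (hGs a) (abs_nonneg _)
    have h₅ : |deriv (f a) s * (v - s)| ≤ G * ∑ b, |x b - v| := by
      rw [abs_mul]
      exact mul_le_mul (hGs a) hs (abs_nonneg _) hG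
    linarith [le_abs_self (deriv (f a) (x a) * (x a - v)),
      neg_abs_le (deriv (f a) s * (x a - v)), neg_abs_le (deriv (f a) s * (v - s))]
  have hsum := Finset.sum_le_sum fun a (_ : a ∈ Finset.univ) => hterm a
  rw [Finset.sum_sub_distrib, Finset.sum_sub_distrib, Finset.sum_sub_distrib,
    ← Finset.mul_sum, Finset.sum_const, Finset.card_univ, nsmul_eq_mul] at hsum
  linarith

/-- Absorbing the consensus error of a step of length `α` into the disagreement. -/
theorem two_mul_mul_sum_abs_le {ι : Type*} [Fintype ι] [Nonempty ι] (y : ι → ℝ) (α K : ℝ) :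
    2 * α * (K * ∑ a, |y a|) ≤
      1 / 2 * ∑ a, y a ^ 2 + 2 * Fintype.card ι * K ^ 2 * α ^ 2 := by
  have hn : (0 : ℝ) < Fintype.card ι := by exact_mod_cast Fintype.card_pos
  have hcs : (∑ a, |y a|) ^ 2 ≤ Fintype.card ι * ∑ a, y a ^ 2 := by
    simpa using sq_sum_le_card_mul_sum_sq (s := Finset.univ) (f := fun a => |y a|)
  refine le_of_mul_le_mul_left ?_ hn
  nlinarith [sq_nonneg ((∑ a, |y a|) - 2 * Fintype.card ι * K * α)]

/-- If a sum of squares tends to zero, so does every term. -/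
theorem tendsto_zero_of_tendsto_sum_sq {ι κ : Type*} [Fintype ι] {l : Filter κ} {y : κ → ι → ℝ}
    (h : Tendsto (fun k => ∑ a, y k a ^ 2) l (𝓝 0)) (a : ι) :
    Tendsto (fun k => y k a) l (𝓝 0) := by
  have hsq : Tendsto (fun k => y k a ^ 2) l (𝓝 0) :=
    squeeze_zero (fun _ => sq_nonneg _)
      (fun k => Finset.single_le_sum (f := fun b => y k b ^ 2)
        (fun _ _ => sq_nonneg _) (Finset.mem_univ a)) h
  rw [tendsto_zero_iff_abs_tendsto_zero]
  simpa [Function.comp_def, Real.sqrt_sq_eq_abs] using hsq.sqrt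

/-- **Convergence of the projected consensus gradient method.** For `W` agents with
interval constraints `X_a = [lo a, hi a]` (with nonempty intersection `X`), convex
differentiable objectives `f a` with continuous derivatives, and stepsizes with
`∑ α = ∞` and `∑ α² < ∞`, the projected consensus iterates
`x (k+1) a = Π_{X_a}[(1/W) ∑_b x k b - α k * (f a)'(x k a)]` all converge to a
common minimizer `x*` of `∑ a, f a` over `X`. -/
theorem projected_consensus_gradient_converges
    (W : ℕ) (hW : 1 ≤ W) (lo hi : Fin W → ℝ) (hlohi : ∀ a, lo a ≤ hi a)
    (X : Set ℝ) (hX : X = ⋂ a, Set.Icc (lo a) (hi a)) (hXne : X.Nonempty)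
    (f : Fin W → ℝ → ℝ)
    (hconv : ∀ a, ConvexOn ℝ Set.univ (f a))
    (hdiff : ∀ a, Differentiable ℝ (f a))
    (hcont : ∀ a, Continuous (deriv (f a)))
    (α : ℕ → ℝ) (hαpos : ∀ k, 0 < α k)
    (hαdiv : ¬ Summable α) (hαsq : Summable (fun k => (α k) ^ 2))
    (x : ℕ → Fin W → ℝ)
    (hx0 : ∀ a, x 0 a ∈ Set.Icc (lo a) (hi a))
    (hupd : ∀ k a, x (k + 1) a =
      min (max ((1 / (W : ℝ)) * (∑ b, x k b) - α k * deriv (f a) (x k a)) (lo a))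
        (hi a)) :
    ∃ xstar ∈ X, (∀ y ∈ X, (∑ a, f a xstar) ≤ ∑ a, f a y) ∧
      ∀ a, Tendsto (fun k => x k a) atTop (nhds xstar) := by
  subst hX
  have : Nonempty (Fin W) := ⟨⟨0, hW⟩⟩
  have hW0 : (W : ℝ) ≠ 0 := by positivity
  have hmem : ∀ k a, x k a ∈ Set.Icc (lo a) (hi a) := by
    intro k a
    cases k with
    | zero => exact hx0 a
    | succ k =>
      rw [hupd]
      exact ⟨le_min (le_max_right _ _) (hlohi a), min_le_right _ _⟩
  obtain ⟨G, hG0, hG⟩ : ∃ G, 0 ≤ G ∧ ∀ a, ∀ y ∈ Set.Icc (lo a) (hi a), |deriv (f a) y| ≤ G := by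
    choose C hC using fun a =>
      (isCompact_Icc (a := lo a) (b := hi a)).exists_bound_of_continuousOn (hcont a).continuousOn
    refine ⟨∑ a, |C a|, Finset.sum_nonneg fun _ _ => abs_nonneg _, fun a y hy => ?_⟩
    exact ((hC a y hy).trans (le_abs_self _)).trans
      (Finset.single_le_sum (f := fun b => |C b|) (fun _ _ => abs_nonneg _) (Finset.mem_univ a))
  have hcompact : IsCompact (⋂ a, Set.Icc (lo a) (hi a)) :=
    (isCompact_Icc (a := lo ⟨0, hW⟩) (b := hi ⟨0, hW⟩)).of_isClosed_subset
      (isClosed_iInter fun _ => isClosed_Icc) (Set.iInter_subset _ _)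
  have hFcont : Continuous fun y => ∑ a, f a y :=
    continuous_finsetSum _ fun a _ => (hdiff a).continuous
  obtain ⟨z, hz, hzmin⟩ := hcompact.exists_isMinOn hXne hFcont.continuousOn
  set v : ℕ → ℝ := fun k => (1 / (W : ℝ)) * ∑ b, x k b with hv
  choose s hsX hs using fun k => exists_mem_iInter_Icc_abs_sub_le hXne (hmem k) (v k)
  have hgap : ∀ k, 0 ≤ ∑ a, f a (s k) - ∑ a, f a z := fun k => sub_nonneg.2 (hzmin (hsX k))
  have hdis : ∀ k, 0 ≤ ∑ a, (x k a - v k) ^ 2 := fun k => Finset.sum_nonneg fun _ _ => sq_nonneg _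
  obtain ⟨C, hC0, hstep⟩ : ∃ C, 0 ≤ C ∧ ∀ y ∈ ⋂ a, Set.Icc (lo a) (hi a), ∀ k,
      ∑ a, (x (k + 1) a - y) ^ 2 ≤ ∑ a, (x k a - y) ^ 2 -
        (1 / 2 * ∑ a, (x k a - v k) ^ 2 + 2 * (α k * (∑ a, f a (s k) - ∑ a, f a y))) +
        C * α k ^ 2 := by
    refine ⟨2 * W * ((W + 2) * G) ^ 2 + W * G ^ 2, by positivity, fun y hy k => ?_⟩
    have h₁ := sum_sq_clamp_sub_le (x := x k) (v := v k) (α := α k)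
      (g := fun a => deriv (f a) (x k a)) (Set.mem_iInter.1 hy)
      (by rw [Fintype.card_fin, hv]; field_simp)
    have h₂ := sub_le_sum_deriv_mul_sub hconv hdiff (z := y) (fun a => hG a _ (hmem k a))
      (fun a => hG a _ (Set.mem_iInter.1 (hsX k) a)) hG0 (hs k)
    have h₃ := two_mul_mul_sum_abs_le (fun a => x k a - v k) (α k) ((W + 2) * G)
    have h₄ : ∑ a, deriv (f a) (x k a) ^ 2 ≤ W * G ^ 2 := by
      refine (Finset.sum_le_card_nsmul _ _ (G ^ 2) fun a _ => ?_).trans_eq (by simp)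
      exact sq_le_sq.2 ((hG a _ (hmem k a)).trans (le_abs_self G))
    rw [Fintype.card_fin] at h₂ h₃
    have h₅ := mul_le_mul_of_nonneg_left h₂ (mul_nonneg zero_le_two (hαpos k).le)
    have h₆ := mul_le_mul_of_nonneg_left h₄ (sq_nonneg (α k))
    simp only [hupd k]
    linarith
  have hlim : ∀ y ∈ ⋂ a, Set.Icc (lo a) (hi a), (∀ k, ∑ a, f a y ≤ ∑ a, f a (s k)) →
      (∃ l, Tendsto (fun k => ∑ a, (x k a - y) ^ 2) atTop (𝓝 l)) ∧
      Summable fun k => 1 / 2 * ∑ a, (x k a - v k) ^ 2 +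
        2 * (α k * (∑ a, f a (s k) - ∑ a, f a y)) := fun y hy hmin =>
    exists_tendsto_and_summable_of_le_sub_add
      (fun k => Finset.sum_nonneg fun _ _ => sq_nonneg _)
      (fun k => add_nonneg (mul_nonneg (by norm_num) (hdis k))
        (mul_nonneg zero_le_two (mul_nonneg (hαpos k).le (sub_nonneg.2 (hmin k)))))
      (fun k => mul_nonneg hC0 (sq_nonneg _)) (hαsq.mul_left C) (hstep y hy)
  have hsummable := (hlim z hz fun k => hzmin (hsX k)).2
  have hdis_summable : Summable fun k => ∑ a, (x k a - v k) ^ 2 :=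
    Summable.of_nonneg_of_le hdis
      (fun k => by linarith [mul_nonneg (hαpos k).le (hgap k)]) (hsummable.mul_left 2)
  have hgap_summable : Summable fun k => α k * (∑ a, f a (s k) - ∑ a, f a z) :=
    Summable.of_nonneg_of_le (fun k => mul_nonneg (hαpos k).le (hgap k))
      (fun k => by linarith [mul_nonneg (hαpos k).le (hgap k), hdis k]) hsummable
  have hxv : ∀ a, Tendsto (fun k => x k a - v k) atTop (𝓝 0) :=
    tendsto_zero_of_tendsto_sum_sq hdis_summable.tendsto_atTop_zero
  have hvs : Tendsto (fun k => v k - s k) atTop (𝓝 0) := by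
    refine squeeze_zero_norm hs ?_
    simpa using tendsto_finsetSum Finset.univ fun a _ => (hxv a).abs
  have hxs : ∀ a, Tendsto (fun k => x k a - s k) atTop (𝓝 0) := fun a => by
    simpa using (hxv a).add hvs
  obtain ⟨φ, hφ, hφgap⟩ := extraction_forall_of_frequently fun n : ℕ =>
    frequently_lt_of_summable_mul hαpos hαdiv hgap_summable (Nat.one_div_pos_of_nat (n := n))
  obtain ⟨y, hy, ψ, hψ, hsy⟩ := hcompact.tendsto_subseq fun n => hsX (φ n)
  have hsub : Tendsto (fun n => φ (ψ n)) atTop atTop :=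
    hφ.tendsto_atTop.comp hψ.tendsto_atTop
  have hyz : ∑ a, f a y ≤ ∑ a, f a z := by
    refine le_of_tendsto_of_tendsto ((hFcont.tendsto y).comp hsy)
      (g := fun n => ∑ a, f a z + 1 / ((ψ n : ℝ) + 1)) ?_
      (Eventually.of_forall fun n => ?_)
    · simpa using
        (tendsto_one_div_add_atTop_nhds_zero_nat.comp hψ.tendsto_atTop).const_add (∑ a, f a z)
    · have := hφgap (ψ n)
      simp only [Function.comp_apply]
      linarith
  have hymin : ∀ w ∈ ⋂ a, Set.Icc (lo a) (hi a), ∑ a, f a y ≤ ∑ a, f a w := fun w hw =>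
    hyz.trans (hzmin hw)
  refine ⟨y, hy, hymin, fun a => ?_⟩
  obtain ⟨l, hl⟩ := (hlim y hy fun k => hymin _ (hsX k)).1
  have hsub_zero : Tendsto (fun n => ∑ b, (x (φ (ψ n)) b - y) ^ 2) atTop (𝓝 0) := by
    have hxy : ∀ b, Tendsto (fun n => (x (φ (ψ n)) b - y) ^ 2) atTop (𝓝 0) := fun b => by
      simpa using ((((hxs b).comp hsub).add hsy).sub_const y).pow 2
    simpa using tendsto_finsetSum Finset.univ fun b _ => hxy b
  obtain rfl : l = 0 := tendsto_nhds_unique (hl.comp hsub) hsub_zero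
  exact tendsto_sub_nhds_zero_iff.1 (tendsto_zero_of_tendsto_sum_sq hl a)
end
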